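/- Let A be a Noetherian integral domain, B an A-algebra of finite type, and M a finite B-module. Then there exists a nonzero element f ∈ A such that for every field κ and every ring homomorphism A → κ under which f maps to a nonzero (hence invertible) element, the canonical map Hom_B(M, B) ⊗_A κ → Hom_{B ⊗_A κ}(M ⊗_A κ, B ⊗_A κ), sending φ ⊗ c to the (B ⊗_A κ)-linear map m ⊗ d ↦ φ(m) ⊗ (c·d), is bijective. -/

import Mathlib

open TensorProduct

universe w

/-- An extension of flat modules is flat. -/
lemma Module.Flat.of_exact {R M₁ M₂ M₃ : Type*} [CommRing R] [AddCommGroup M₁] [Module R M₁]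
    [AddCommGroup M₂] [Module R M₂] [AddCommGroup M₃] [Module R M₃]
    {f : M₁ →ₗ[R] M₂} {g : M₂ →ₗ[R] M₃} (hf : Function.Injective f) (hg : Function.Surjective g)
    (hfg : Function.Exact f g) [Module.Flat R M₁] [Module.Flat R M₃] : Module.Flat R M₂ := by
  refine Module.Flat.iff_rTensor_injective'.mpr fun I ↦ ?_
  rw [injective_iff_map_eq_zero]
  intro x hx
  have hgx : g.lTensor I x = 0 := by
    refine (injective_iff_map_eq_zero _).mp
      (Module.Flat.rTensor_preserves_injective_linearMap (M := M₃) I.subtype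
        I.injective_subtype) _ ?_
    rw [← LinearMap.comp_apply, LinearMap.rTensor_comp_lTensor, ← LinearMap.lTensor_comp_rTensor,
      LinearMap.comp_apply, hx, map_zero]
  obtain ⟨y, rfl⟩ := (_root_.lTensor_exact I hfg hg x).mp hgx
  have hy : I.subtype.rTensor M₁ y = 0 := by
    refine (injective_iff_map_eq_zero _).mp
      (Module.Flat.lTensor_preserves_injective_linearMap (M := R) f hf) _ ?_
    rw [← LinearMap.comp_apply, LinearMap.lTensor_comp_rTensor, ← LinearMap.rTensor_comp_lTensor,
      LinearMap.comp_apply, hx]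
  rw [(injective_iff_map_eq_zero _).mp
      (Module.Flat.rTensor_preserves_injective_linearMap (M := M₁) I.subtype
        I.injective_subtype) _ hy, map_zero]

/-- The union of an increasing sequence of flat modules is flat. -/
lemma Module.Flat.of_monotone_range {R P : Type*} [CommRing R] [AddCommGroup P] [Module R P]
    {Q : ℕ → Type*} [∀ n, AddCommGroup (Q n)] [∀ n, Module R (Q n)] [∀ n, Module.Flat R (Q n)]
    (i : ∀ n, Q n →ₗ[R] P) (hi : ∀ n, Function.Injective (i n))
    (hmono : Monotone fun n ↦ LinearMap.range (i n))
    (hsup : ∀ x, ∃ n, x ∈ LinearMap.range (i n)) : Module.Flat R P := by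
  refine Module.Flat.of_forall_isTrivialRelation fun {l f x} hfx ↦ ?_
  choose n hn using fun j ↦ hsup (x j)
  choose y hy using fun j ↦ hmono (Finset.le_sup (f := n) (Finset.mem_univ j)) (hn j)
  obtain ⟨k, a, z, hz, ha⟩ := Module.Flat.isTrivialRelation_of_sum_smul_eq_zero (f := f) (x := y)
    (hi _ (by simpa [hy] using hfx))
  refine ⟨k, a, fun j ↦ i _ (z j), fun j ↦ ?_, ha⟩
  rw [← hy, hz]
  simp

/-- Flatness after inverting `f` implies flatness after inverting a multiple of `f`. -/
lemma flat_away_of_dvd {R : Type*} [CommRing R] {f g : R} (h : f ∣ g) (M : Type*)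
    [AddCommGroup M] [Module R M] [Module.Flat R (Localization.Away f ⊗[R] M)] :
    Module.Flat R (Localization.Away g ⊗[R] M) := by
  let φ : Localization.Away f →+* Localization.Away g :=
    IsLocalization.Away.lift (g := algebraMap R (Localization.Away g)) f
      (isUnit_of_dvd_unit (map_dvd _ h) (IsLocalization.Away.algebraMap_isUnit g))
  let _ : Algebra (Localization.Away f) (Localization.Away g) := φ.toAlgebra
  have : IsScalarTower R (Localization.Away f) (Localization.Away g) :=
    .of_algebraMap_eq fun x ↦ (IsLocalization.Away.lift_eq f _ x).symm
  have : Module.Flat R (Localization.Away g) := IsLocalization.flat _ (.powers g)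
  let e := (IsLocalization.moduleLid (.powers f) (Localization.Away f)
    (Localization.Away g)).restrictScalars R
  exact Module.Flat.of_linearEquiv ((((TensorProduct.comm R _ _).trans e).symm.rTensor M).trans
    (TensorProduct.assoc R _ _ M))

/-- If `M₃` is flat after inverting `f`, then exactness of `0 → M₁ → M₂ → M₃ → 0` is preserved by
base change to any algebra in which `f` is invertible. -/
lemma rTensor_injective_of_flat_away {R : Type*} [CommRing R] {f : R} (K : Type*) [CommRing K]
    [Algebra R K] (hf : IsUnit (algebraMap R K f)) {M₁ M₂ M₃ : Type*} [AddCommGroup M₁]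
    [Module R M₁] [AddCommGroup M₂] [Module R M₂] [AddCommGroup M₃] [Module R M₃]
    {i : M₁ →ₗ[R] M₂} {p : M₂ →ₗ[R] M₃} (hi : Function.Injective i) (hp : Function.Surjective p)
    (hip : Function.Exact i p) [Module.Flat R (Localization.Away f ⊗[R] M₃)] :
    Function.Injective (i.rTensor K) := by
  rw [← LinearMap.lTensor_inj_iff_rTensor_inj]
  let _ : Algebra (Localization.Away f) K := (IsLocalization.Away.lift f hf).toAlgebra
  have : IsScalarTower R (Localization.Away f) K :=
    .of_algebraMap_eq fun x ↦ (IsLocalization.Away.lift_eq f _ x).symm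
  have : Module.Flat R (Localization.Away f) := IsLocalization.flat _ (.powers f)
  let e := (TensorProduct.comm R _ _).trans
    ((IsLocalization.moduleLid (.powers f) (Localization.Away f) K).restrictScalars R)
  have H := LinearMap.lTensor_injective_of_exact_of_flat (p.lTensor (Localization.Away f))
    (LinearMap.lTensor_surjective _ hp) (i.lTensor (Localization.Away f))
    (Module.Flat.lTensor_preserves_injective_linearMap i hi) (lTensor_exact _ hip hp) K
  have H' : Function.Injective (i.lTensor (K ⊗[R] Localization.Away f)) := by
    rw [LinearMap.lTensor_tensor]
    exact (TensorProduct.assoc R _ _ _).symm.injective.comp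
      (H.comp (TensorProduct.assoc R _ _ _).injective)
  have key : (e.rTensor M₂).toLinearMap ∘ₗ i.lTensor (K ⊗[R] Localization.Away f) =
      i.lTensor K ∘ₗ (e.rTensor M₁).toLinearMap := by
    rw [LinearEquiv.coe_rTensor, LinearEquiv.coe_rTensor, LinearMap.rTensor_comp_lTensor,
      LinearMap.lTensor_comp_rTensor]
  rw [← Function.Injective.of_comp_iff' _ (e.rTensor M₁).bijective]
  change Function.Injective (i.lTensor K ∘ₗ (e.rTensor M₁).toLinearMap)
  rw [← key]
  exact (e.rTensor M₂).injective.comp H'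

/-- The module `M` becomes flat after inverting some nonzero element of `A`. -/
def GenericallyFlat (A M : Type*) [CommRing A] [AddCommGroup M] [Module A M] : Prop :=
  ∃ f : A, f ≠ 0 ∧ Module.Flat A (Localization.Away f ⊗[A] M)

lemma genericallyFlat_of_finite (A M : Type*) [CommRing A] [IsDomain A] [IsNoetherianRing A]
    [AddCommGroup M] [Module A M] [Module.Finite A M] : GenericallyFlat A M := by
  have : Module.FinitePresentation A M := Module.finitePresentation_of_finite A M
  obtain ⟨r, hr, hfree, -⟩ := Module.FinitePresentation.exists_free_localizedModule_powers
    (nonZeroDivisors A) (LocalizedModule.mkLinearMap (nonZeroDivisors A) M) (FractionRing A)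
  refine ⟨r, nonZeroDivisors.ne_zero hr, ?_⟩
  have : Module.Flat A (LocalizedModule.Away r M) :=
    (Module.flat_iff_of_isLocalization (Localization (.powers r)) (.powers r) _).mp inferInstance
  exact Module.Flat.of_linearEquiv
    ((LocalizedModule.equivTensorProduct (.powers r) M).restrictScalars A).symm

lemma exists_forall_flat_away {A : Type*} [CommRing A] [IsDomain A] (s : ℕ) {Q : ℕ → Type*}
    [∀ n, AddCommGroup (Q n)] [∀ n, Module A (Q n)] (h : ∀ n, GenericallyFlat A (Q n)) :
    ∃ f : A, f ≠ 0 ∧ ∀ n < s, Module.Flat A (Localization.Away f ⊗[A] Q n) := by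
  choose g hg hflat using h
  refine ⟨∏ n ∈ Finset.range s, g n, Finset.prod_ne_zero_iff.mpr fun n _ ↦ hg n, fun n hn ↦ ?_⟩
  exact flat_away_of_dvd (Finset.dvd_prod_of_mem g (Finset.mem_range.mpr hn)) _

lemma Module.Flat.tensor_of_exact {R L M₁ M₂ M₃ : Type*} [CommRing R] [AddCommGroup M₁]
    [Module R M₁] [AddCommGroup M₂] [Module R M₂] [AddCommGroup M₃] [Module R M₃]
    [AddCommGroup L] [Module R L] [Module.Flat R L]
    {f : M₁ →ₗ[R] M₂} {g : M₂ →ₗ[R] M₃} (hf : Function.Injective f) (hg : Function.Surjective g)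
    (hfg : Function.Exact f g) (h₁ : Module.Flat R (L ⊗[R] M₁))
    (h₃ : Module.Flat R (L ⊗[R] M₃)) : Module.Flat R (L ⊗[R] M₂) :=
  .of_exact (Module.Flat.lTensor_preserves_injective_linearMap (M := L) f hf)
    (LinearMap.lTensor_surjective L hg) (_root_.lTensor_exact L hfg hg)

/-- If `Q = P + g(N)` with `g : N → M`, then `Q → Q / P` identifies with a surjection
`Q → N / g⁻¹(P)`. -/
lemma exists_surjective_ker_of_eq_sup_range {B M N : Type*} [Ring B] [AddCommGroup M]
    [Module B M] [AddCommGroup N] [Module B N] {P Q : Submodule B M} {g : N →ₗ[B] M}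
    (hQ : Q = P ⊔ LinearMap.range g) :
    ∃ p : Q →ₗ[B] N ⧸ P.comap g, Function.Surjective p ∧ LinearMap.ker p = P.submoduleOf Q := by
  let φ : N →ₗ[B] Q ⧸ P.submoduleOf Q := (P.submoduleOf Q).mkQ ∘ₗ g.codRestrict Q fun x ↦
    hQ ▸ Submodule.mem_sup_right ⟨x, rfl⟩
  have hker : LinearMap.ker φ = P.comap g := by
    ext x
    exact Submodule.Quotient.mk_eq_zero _
  have hφ : Function.Surjective φ := by
    intro y
    obtain ⟨⟨y, hy⟩, rfl⟩ := Submodule.mkQ_surjective _ y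
    have hy' := hy
    rw [hQ] at hy'
    obtain ⟨a, ha, _, ⟨x, rfl⟩, rfl⟩ := Submodule.mem_sup.mp hy'
    refine ⟨x, (Submodule.Quotient.eq _).mpr ?_⟩
    simpa [Submodule.submoduleOf] using ha
  let e := (Submodule.quotEquivOfEq _ _ hker).symm.trans (φ.quotKerEquivOfSurjective hφ)
  refine ⟨e.symm.toLinearMap ∘ₗ (P.submoduleOf Q).mkQ,
    e.symm.surjective.comp (Submodule.mkQ_surjective _), ?_⟩
  rw [LinearEquiv.ker_comp, Submodule.ker_mkQ]

lemma flat_tensor_of_eq_sup_range {A B L M N : Type*} [CommRing A] [CommRing B]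
    [Algebra A B] [AddCommGroup M] [Module A M] [Module B M] [IsScalarTower A B M]
    [AddCommGroup N] [Module A N] [Module B N] [IsScalarTower A B N]
    [AddCommGroup L] [Module A L] [Module.Flat A L] {P Q : Submodule B M} {g : N →ₗ[B] M}
    (hQ : Q = P ⊔ LinearMap.range g) (hP : Module.Flat A (L ⊗[A] P))
    (hN : Module.Flat A (L ⊗[A] (N ⧸ P.comap g))) : Module.Flat A (L ⊗[A] Q) := by
  have hle : P ≤ Q := hQ ▸ le_sup_left
  obtain ⟨p, hp, hker⟩ := exists_surjective_ker_of_eq_sup_range hQ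
  refine Module.Flat.tensor_of_exact (f := (Submodule.inclusion hle).restrictScalars A)
    (g := p.restrictScalars A) (Submodule.inclusion_injective hle) hp (fun x ↦ ?_) hP hN
  change x ∈ LinearMap.ker p ↔ _
  rw [hker]
  refine ⟨fun h ↦ ⟨⟨x, h⟩, rfl⟩, ?_⟩
  rintro ⟨y, rfl⟩
  exact y.2

lemma flat_tensor_of_iSup {A B L M : Type*} [CommRing A] [CommRing B]
    [Algebra A B] [AddCommGroup M] [Module A M] [Module B M] [IsScalarTower A B M]
    [AddCommGroup L] [Module A L] [Module.Flat A L] {F : ℕ → Submodule B M} (hF : Monotone F)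
    (hsup : ∀ x, ∃ n, x ∈ F n) (h : ∀ n, Module.Flat A (L ⊗[A] F n)) :
    Module.Flat A (L ⊗[A] M) := by
  let i (n : ℕ) : F n →ₗ[A] M := (F n).subtype.restrictScalars A
  have hmono : Monotone fun n ↦ LinearMap.range ((i n).lTensor L) := by
    intro m n hmn
    have : i m = i n ∘ₗ (Submodule.inclusion (hF hmn)).restrictScalars A := rfl
    simp only [this, LinearMap.lTensor_comp]
    exact LinearMap.range_comp_le_range _ _
  refine .of_monotone_range (Q := fun n ↦ L ⊗[A] F n) (fun n ↦ (i n).lTensor L)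
    (fun n ↦ Module.Flat.lTensor_preserves_injective_linearMap _ (F n).injective_subtype)
    hmono fun x ↦ ?_
  induction x with
  | zero => exact ⟨0, zero_mem _⟩
  | tmul l m =>
    obtain ⟨n, hn⟩ := hsup m
    exact ⟨n, l ⊗ₜ ⟨m, hn⟩, rfl⟩
  | add x y hx hy =>
    obtain ⟨m, hm⟩ := hx
    obtain ⟨n, hn⟩ := hy
    exact ⟨max m n, add_mem (hmono (le_max_left m n) hm) (hmono (le_max_right m n) hn)⟩

/-- A module exhausted by an increasing filtration, whose graded pieces are quotients of a fixed
Noetherian module by an increasing chain of submodules, is generically flat if all these quotients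
are. -/
lemma genericallyFlat_of_filtration {A B M N : Type*} [CommRing A] [IsDomain A] [CommRing B]
    [Algebra A B] [AddCommGroup M] [Module A M] [Module B M] [IsScalarTower A B M]
    [AddCommGroup N] [Module A N] [Module B N] [IsScalarTower A B N] [IsNoetherian B N]
    (F : ℕ → Submodule B M) (g : ℕ → N →ₗ[B] M) (hF₀ : F 0 = ⊥)
    (hF : ∀ n, F (n + 1) = F n ⊔ LinearMap.range (g n)) (hsup : ∀ x, ∃ n, x ∈ F n)
    (hmono : Monotone fun n ↦ (F n).comap (g n))
    (hN : ∀ K : Submodule B N, GenericallyFlat A (N ⧸ K)) : GenericallyFlat A M := by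
  obtain ⟨s, hs⟩ := monotone_stabilizes_iff_noetherian.mpr ‹IsNoetherian B N› ⟨_, hmono⟩
  obtain ⟨f, hf, hflat⟩ := exists_forall_flat_away (s + 1) fun n ↦ hN ((F n).comap (g n))
  have hflat' (n : ℕ) :
      Module.Flat A (Localization.Away f ⊗[A] (N ⧸ (F n).comap (g n))) := by
    rcases lt_or_ge n (s + 1) with h | h
    · exact hflat n h
    · have := hs n (by omega)
      simp only [OrderHom.coe_mk] at this
      rw [← this]
      exact hflat s (by omega)
  refine ⟨f, hf, ?_⟩
  have : Module.Flat A (Localization.Away f) := IsLocalization.flat _ (.powers f)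
  refine flat_tensor_of_iSup (monotone_nat_of_le_succ fun n ↦ hF n ▸ le_sup_left) hsup fun n ↦ ?_
  induction n with
  | zero =>
    have : Subsingleton (F 0) := by rw [hF₀]; infer_instance
    infer_instance
  | succ n ih => exact flat_tensor_of_eq_sup_range (hF n) ih (hflat' n)

open Polynomial in
lemma genericallyFlat_polynomial {A B M : Type w} [CommRing A] [IsDomain A] [CommRing B]
    [IsNoetherianRing B] [Algebra A B]
    (hB : ∀ (N : Type w) [AddCommGroup N] [Module A N] [Module B N] [IsScalarTower A B N]
      [Module.Finite B N], GenericallyFlat A N)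
    [AddCommGroup M] [Module A M] [Module B[X] M] [IsScalarTower A B[X] M]
    [Module.Finite B[X] M] : GenericallyFlat A M := by
  let _ : Module B M := Module.compHom M (C : B →+* B[X])
  have hBM : IsScalarTower B B[X] M := ⟨fun b p m ↦ by
    rw [Polynomial.smul_eq_C_mul, mul_smul]; rfl⟩
  have : IsScalarTower A B M := ⟨fun a b m ↦ by
    change C (a • b) • m = a • C b • m
    rw [← Polynomial.smul_C, smul_assoc]⟩
  obtain ⟨s, hs⟩ := Module.Finite.fg_top (R := B[X]) (M := M)
  let N : Submodule B M := Submodule.span B s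
  have : Module.Finite B N := Module.Finite.span_of_finite B s.finite_toSet
  let T : M →ₗ[B] M := (Module.toModuleEnd B (S := B[X]) M X)
  let F (n : ℕ) : Submodule B M :=
    Nat.rec ⊥ (fun n P ↦ P ⊔ LinearMap.range ((T ^ n) ∘ₗ N.subtype)) n
  have hF (n) : F (n + 1) = F n ⊔ LinearMap.range ((T ^ n) ∘ₗ N.subtype) := rfl
  have hmono : Monotone F := monotone_nat_of_le_succ fun n ↦ hF n ▸ le_sup_left
  have hTF (n) : (F n).map T ≤ F (n + 1) := by
    induction n with
    | zero => simp [F]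
    | succ n ih =>
      rw [hF n, Submodule.map_sup, hF (n + 1)]
      refine sup_le_sup ih ?_
      rw [← LinearMap.range_comp, ← LinearMap.comp_assoc, pow_succ' T]
      rfl
  refine genericallyFlat_of_filtration F (fun n ↦ (T ^ n) ∘ₗ N.subtype) rfl hF ?_ ?_ fun K ↦ hB _
  · have hX (m) (hm : m ∈ ⨆ n, F n) : T m ∈ ⨆ n, F n := by
      have : (⨆ n, F n).map T ≤ ⨆ n, F n := by
        rw [Submodule.map_iSup]
        exact iSup_le fun n ↦ (hTF n).trans (le_iSup F (n + 1))
      exact this (Submodule.mem_map_of_mem hm)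
    let S : Submodule B[X] M :=
      { (⨆ n, F n) with
        smul_mem' p m hm := by
          change p • m ∈ ⨆ n, F n
          replace hm : m ∈ ⨆ n, F n := hm
          induction p using Polynomial.induction_on' with
          | add p q hp hq => rw [add_smul]; exact add_mem hp hq
          | monomial n b =>
            rw [← Polynomial.C_mul_X_pow_eq_monomial, mul_smul]
            refine (⨆ n, F n).smul_mem b ?_
            induction n with
            | zero => simpa using hm
            | succ n ih => rw [pow_succ', mul_smul]; exact hX _ ih }
    have hS : S = ⊤ := by
      rw [eq_top_iff, ← hs]
      refine Submodule.span_le.mpr fun m hm ↦ ?_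
      refine (le_iSup F 1 : F 1 ≤ _) (Submodule.mem_sup_right ⟨⟨m, Submodule.subset_span hm⟩, rfl⟩)
    exact fun x ↦ (Submodule.mem_iSup_of_directed F hmono.directed_le).mp
      (show x ∈ S from hS ▸ Submodule.mem_top)
  · refine monotone_nat_of_le_succ fun n x hx ↦ ?_
    have := hTF n (Submodule.mem_map_of_mem hx)
    simpa [pow_succ'] using this

lemma genericallyFlat_of_surjective {A B C M : Type w} [CommRing A] [CommRing B] [CommRing C]
    [Algebra A B] [Algebra A C] (φ : B →ₐ[A] C) (hφ : Function.Surjective φ)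
    (hB : ∀ (N : Type w) [AddCommGroup N] [Module A N] [Module B N] [IsScalarTower A B N]
      [Module.Finite B N], GenericallyFlat A N)
    [AddCommGroup M] [Module A M] [Module C M] [IsScalarTower A C M]
    [Module.Finite C M] : GenericallyFlat A M := by
  let _ : Module B M := Module.compHom M φ.toRingHom
  have : IsScalarTower A B M := ⟨fun a b m ↦ by
    change φ (a • b) • m = a • φ b • m
    rw [map_smul, smul_assoc]⟩
  let _ : Algebra B C := φ.toRingHom.toAlgebra
  have : IsScalarTower B C M := ⟨fun b c m ↦ by
    rw [Algebra.smul_def, mul_smul]; rfl⟩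
  have : Module.Finite B C := .of_surjective (Algebra.linearMap B C) hφ
  have : Module.Finite B M := .trans C M
  exact hB M

lemma genericallyFlat_mvPolynomial {A : Type w} [CommRing A] [IsDomain A] [IsNoetherianRing A]
    (n : ℕ) (M : Type w) [AddCommGroup M] [Module A M] [Module (MvPolynomial (Fin n) A) M]
    [IsScalarTower A (MvPolynomial (Fin n) A) M] [Module.Finite (MvPolynomial (Fin n) A) M] :
    GenericallyFlat A M := by
  induction n generalizing M with
  | zero =>
    have : Module.Finite A (MvPolynomial (Fin 0) A) :=
      .equiv (MvPolynomial.isEmptyAlgEquiv A (Fin 0)).symm.toLinearEquiv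
    have : Module.Finite A M := .trans (MvPolynomial (Fin 0) A) M
    exact genericallyFlat_of_finite A M
  | succ n ih =>
    exact genericallyFlat_of_surjective (MvPolynomial.finSuccEquiv A n).symm.toAlgHom
      (MvPolynomial.finSuccEquiv A n).symm.surjective
      fun N _ _ _ _ _ ↦ genericallyFlat_polynomial ih

/-- **Generic flatness**: a finite module over a finite type algebra over a Noetherian domain `A`
becomes flat after inverting a nonzero element of `A`. -/
theorem genericallyFlat_of_finiteType {A B M : Type w} [CommRing A] [IsDomain A]
    [IsNoetherianRing A] [CommRing B] [Algebra A B] [Algebra.FiniteType A B] [AddCommGroup M]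
    [Module A M] [Module B M] [IsScalarTower A B M] [Module.Finite B M] :
    GenericallyFlat A M := by
  obtain ⟨n, φ, hφ⟩ := Algebra.FiniteType.iff_quotient_mvPolynomial''.mp ‹Algebra.FiniteType A B›
  exact genericallyFlat_of_surjective φ hφ fun N ↦ genericallyFlat_mvPolynomial n N

lemma exact_rTensor_of_flat_away {R H X I Y Q : Type*} [CommRing R]
    [AddCommGroup H] [Module R H] [AddCommGroup X] [Module R X] [AddCommGroup I] [Module R I]
    [AddCommGroup Y] [Module R Y] [AddCommGroup Q] [Module R Q]
    {e : H →ₗ[R] X} {d : X →ₗ[R] I} {i : I →ₗ[R] Y} {p : Y →ₗ[R] Q}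
    (he : Function.Injective e) (hed : Function.Exact e d) (hd : Function.Surjective d)
    (hi : Function.Injective i) (hip : Function.Exact i p) (hp : Function.Surjective p) {f g : R}
    [Module.Flat R (Localization.Away f ⊗[R] I)] [Module.Flat R (Localization.Away g ⊗[R] Q)]
    (K : Type*) [CommRing K] [Algebra R K] (hf : IsUnit (algebraMap R K f))
    (hg : IsUnit (algebraMap R K g)) :
    Function.Injective (e.rTensor K) ∧ Function.Exact (e.rTensor K) ((i ∘ₗ d).rTensor K) := by
  refine ⟨rTensor_injective_of_flat_away K hf he hd hed, fun x ↦ ?_⟩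
  rw [← rTensor_exact K hed hd x, LinearMap.rTensor_comp, LinearMap.comp_apply,
    map_eq_zero_iff _ (rTensor_injective_of_flat_away K hg hi hp hip)]

/-- Left exactness of `e`, `d` survives base change along `A → K` when some nonzero element of
`A` becomes a unit in `K`. -/
lemma exact_rTensor_of_genericallyFlat {A B H X Y : Type w} [CommRing A] [IsDomain A] [CommRing B]
    [Algebra A B] [AddCommGroup H] [Module A H] [Module B H] [IsScalarTower A B H]
    [AddCommGroup X] [Module A X] [Module B X] [IsScalarTower A B X]
    [AddCommGroup Y] [Module A Y] [Module B Y] [IsScalarTower A B Y]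
    {e : H →ₗ[B] X} {d : X →ₗ[B] Y} (he : Function.Injective e) (hed : Function.Exact e d)
    (hI : GenericallyFlat A (LinearMap.range d)) (hQ : GenericallyFlat A (Y ⧸ LinearMap.range d)) :
    ∃ f : A, f ≠ 0 ∧ ∀ (K : Type w) [CommRing K] [Algebra A K], IsUnit (algebraMap A K f) →
      Function.Injective ((e.restrictScalars A).rTensor K) ∧
        Function.Exact ((e.restrictScalars A).rTensor K) ((d.restrictScalars A).rTensor K) := by
  obtain ⟨f, hf, hfI⟩ := hI
  obtain ⟨g, hg, hgQ⟩ := hQ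
  refine ⟨f * g, mul_ne_zero hf hg, fun K _ _ hK ↦ ?_⟩
  rw [map_mul, IsUnit.mul_iff] at hK
  have hexact : Function.Exact (e.restrictScalars A) (d.rangeRestrict.restrictScalars A) :=
    fun x ↦ Iff.trans Subtype.ext_iff (hed x)
  have hcomp : (LinearMap.range d).subtype.restrictScalars A ∘ₗ d.rangeRestrict.restrictScalars A =
      d.restrictScalars A := rfl
  have hinj : Function.Injective ((LinearMap.range d).subtype.restrictScalars A) :=
    (LinearMap.range d).injective_subtype
  have hmkQ : Function.Exact ((LinearMap.range d).subtype.restrictScalars A)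
      ((LinearMap.range d).mkQ.restrictScalars A) := LinearMap.exact_subtype_mkQ _
  have hsurj : Function.Surjective ((LinearMap.range d).mkQ.restrictScalars A) :=
    fun y ↦ Submodule.mkQ_surjective _ y
  have hrange : Function.Surjective (d.rangeRestrict.restrictScalars A) :=
    fun ⟨_, x, hx⟩ ↦ ⟨x, Subtype.ext hx⟩
  have he' : Function.Injective (e.restrictScalars A) := he
  rw [← hcomp]
  exact exact_rTensor_of_flat_away he' hexact hrange hinj hmkQ hsurj K hK.1 hK.2

lemma sum_rTensor_single_proj {R B K ι : Type*} [CommRing R] [AddCommGroup B] [Module R B]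
    [AddCommGroup K] [Module R K] [Fintype ι] [DecidableEq ι] (w : (ι → B) ⊗[R] K) :
    ∑ i, (LinearMap.single R (fun _ : ι ↦ B) i).rTensor K
      ((LinearMap.proj (R := R) (φ := fun _ : ι ↦ B) i).rTensor K w) = w := by
  induction w with
  | zero => simp
  | tmul y c =>
    simp only [LinearMap.rTensor_tmul, ← TensorProduct.sum_tmul]
    simp [Finset.univ_sum_single]
  | add x y hx hy => simp only [map_add, Finset.sum_add_distrib, hx, hy]

lemma exists_rTensor_proj_eq {R B K ι : Type*} [CommRing R] [AddCommGroup B] [Module R B]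
    [AddCommGroup K] [Module R K] [Fintype ι] [DecidableEq ι] (y : ι → B ⊗[R] K) :
    ∃ w : (ι → B) ⊗[R] K,
      ∀ i, (LinearMap.proj (R := R) (φ := fun _ : ι ↦ B) i).rTensor K w = y i := by
  refine ⟨∑ i, (LinearMap.single R (fun _ : ι ↦ B) i).rTensor K (y i), fun i ↦ ?_⟩
  rw [map_sum, Finset.sum_eq_single i]
  · rw [← LinearMap.rTensor_comp_apply, LinearMap.proj_comp_single_same, LinearMap.rTensor_id_apply]
  · intro j _ hj
    rw [← LinearMap.rTensor_comp_apply, LinearMap.proj_comp_single_ne _ _ _ _ hj.symm]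
    simp
  · simp

/-- Evaluation of linear forms at a finite family of elements. -/
def evalFamily {B M ι : Type*} [CommRing B] [AddCommGroup M] [Module B M] (x : ι → M) :
    (M →ₗ[B] B) →ₗ[B] ι → B :=
  LinearMap.pi fun i ↦ LinearMap.applyₗ (x i)

lemma sum_smul_map_single {B M ι : Type*} [CommRing B] [AddCommGroup M] [Module B M] [Fintype ι]
    [DecidableEq ι] (p : (ι → B) →ₗ[B] M) (y : ι → B) :
    ∑ i, y i • p (Pi.single i 1) = p y := by
  simp only [← map_smul, ← map_sum, ← pi_eq_sum_univ' y]

lemma span_range_map_single {B M ι : Type*} [CommRing B] [AddCommGroup M] [Module B M] [Fintype ι]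
    [DecidableEq ι] {p : (ι → B) →ₗ[B] M} (hp : Function.Surjective p) :
    Submodule.span B (Set.range fun i ↦ p (Pi.single i 1)) = ⊤ := by
  refine eq_top_iff.mpr fun m _ ↦ ?_
  obtain ⟨y, rfl⟩ := hp m
  rw [← sum_smul_map_single p y]
  exact sum_mem fun i _ ↦ Submodule.smul_mem _ _ (Submodule.subset_span ⟨i, rfl⟩)

lemma evalFamily_injective {B M ι : Type*} [CommRing B] [AddCommGroup M] [Module B M] {x : ι → M}
    (hx : Submodule.span B (Set.range x) = ⊤) : Function.Injective (evalFamily (B := B) x) :=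
  fun _ _ h ↦ LinearMap.ext_on_range hx (congrFun h)

lemma sum_toMatrix_smul {B M ι ι' : Type*} [CommRing B] [AddCommGroup M] [Module B M] [Fintype ι]
    [Fintype ι'] [DecidableEq ι] [DecidableEq ι'] {p : (ι → B) →ₗ[B] M} {q : (ι' → B) →ₗ[B] ι → B}
    (hpq : Function.Exact q p) (j : ι') :
    ∑ i, (LinearMap.toMatrix' q).transpose j i • p (Pi.single i 1) = 0 := by
  rw [← hpq.apply_apply_eq_zero (Pi.single j 1), ← sum_smul_map_single p (q _)]
  simp [LinearMap.toMatrix'_apply]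

/-- Homomorphisms into the ring are the exact kernel of the transpose of the relations. -/
lemma exact_evalFamily {B M ι ι' : Type*} [CommRing B] [AddCommGroup M] [Module B M] [Fintype ι]
    [Fintype ι'] [DecidableEq ι] [DecidableEq ι'] {p : (ι → B) →ₗ[B] M} {q : (ι' → B) →ₗ[B] ι → B}
    (hp : Function.Surjective p) (hpq : Function.Exact q p) :
    Function.Exact (evalFamily fun i ↦ p (Pi.single i 1))
      (Matrix.mulVecLin (LinearMap.toMatrix' q).transpose) := by
  refine fun y ↦ ⟨fun hy ↦ ?_, ?_⟩
  · let l : (ι → B) →ₗ[B] B := Fintype.linearCombination B y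
    have hlq : l ∘ₗ q = 0 := by
      refine LinearMap.pi_ext' fun j ↦ LinearMap.ext_ring ?_
      simpa [l, Fintype.linearCombination_apply, Matrix.vecMul, dotProduct, mul_comm,
        LinearMap.toMatrix'_apply] using congrFun hy j
    have hl : LinearMap.ker p ≤ LinearMap.ker l := fun z hz ↦ by
      obtain ⟨w, rfl⟩ := (hpq z).mp hz
      exact LinearMap.congr_fun hlq w
    let φ : M →ₗ[B] B := (LinearMap.ker p).liftQ l hl ∘ₗ (p.quotKerEquivOfSurjective hp).symm
    have hφ (z : ι → B) : φ (p z) = l z := by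
      have : (p.quotKerEquivOfSurjective hp).symm (p z) = Submodule.Quotient.mk z := by
        rw [LinearEquiv.symm_apply_eq]; rfl
      simp [φ, this]
    refine ⟨φ, funext fun i ↦ ?_⟩
    simp [evalFamily, hφ, l, Fintype.linearCombination_apply_single]
  · rintro ⟨φ, rfl⟩
    ext j
    have := congrArg φ (sum_toMatrix_smul hpq j)
    simpa [evalFamily, Matrix.vecMul, dotProduct, mul_comm, LinearMap.toMatrix'_apply] using this

/-- If the presentation of `M` dualizes to a left exact sequence that stays exact after base change
to `K`, then formation of `Hom_B(M, B)` commutes with this base change. -/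
theorem bijective_of_exact {A B K M ι ι' : Type*} [CommRing A] [CommRing B] [Algebra A B]
    [CommRing K] [Algebra A K] [AddCommGroup M] [Module A M] [Module B M] [IsScalarTower A B M]
    [Fintype ι] [Fintype ι'] {x : ι → M} {r : Matrix ι' ι B}
    (hx : Submodule.span B (Set.range x) = ⊤) (hr : ∀ j, ∑ i, r j i • x i = 0)
    (hinj : Function.Injective (((evalFamily (B := B) x).restrictScalars A).rTensor K))
    (hexact : Function.Exact (((evalFamily (B := B) x).restrictScalars A).rTensor K)
      ((r.mulVecLin.restrictScalars A).rTensor K))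
    (Φ : TensorProduct A (M →ₗ[B] B) K →+
            ((TensorProduct A M K) →+ (TensorProduct A B K)))
    (hΦ : ∀ (φ : M →ₗ[B] B) (c : K) (m : M) (d : K),
            Φ (φ ⊗ₜ[A] c) (m ⊗ₜ[A] d) = φ m ⊗ₜ[A] (c * d)) :
    Function.Injective Φ ∧
            Set.range Φ = {h : (TensorProduct A M K) →+ (TensorProduct A B K) |
              ∀ (b : B) (c : K) (m : M) (d : K),
                h ((b • m) ⊗ₜ[A] (c * d)) = (b ⊗ₜ[A] c) * h (m ⊗ₜ[A] d)} := by
  classical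
  have hev (z : (M →ₗ[B] B) ⊗[A] K) (i : ι) :
      (LinearMap.proj (R := A) (φ := fun _ : ι ↦ B) i).rTensor K
        (((evalFamily (B := B) x).restrictScalars A).rTensor K z) = Φ z (x i ⊗ₜ 1) := by
    induction z with
    | zero => simp
    | tmul φ c => simp [hΦ, evalFamily]
    | add z z' hz hz' => simp only [map_add, hz, hz', AddMonoidHom.add_apply]
  have hlin (z : (M →ₗ[B] B) ⊗[A] K) (b : B) (c : K) (m : M) (d : K) :
      Φ z ((b • m) ⊗ₜ[A] (c * d)) = (b ⊗ₜ[A] c) * Φ z (m ⊗ₜ[A] d) := by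
    induction z with
    | zero => simp
    | tmul φ c' => simp [hΦ, mul_left_comm]
    | add z z' hz hz' => simp only [map_add, hz, hz', AddMonoidHom.add_apply, mul_add]
  have hrel (w : (ι → B) ⊗[A] K) (j : ι') :
      (LinearMap.proj (R := A) (φ := fun _ : ι' ↦ B) j).rTensor K
        ((r.mulVecLin.restrictScalars A).rTensor K w) =
      ∑ i, (r j i ⊗ₜ[A] (1 : K)) *
        (LinearMap.proj (R := A) (φ := fun _ : ι ↦ B) i).rTensor K w := by
    induction w with
    | zero => simp
    | tmul y c => simp [Matrix.mulVec, dotProduct, TensorProduct.sum_tmul]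
    | add z z' hz hz' => simp only [map_add, hz, hz', mul_add, Finset.sum_add_distrib]
  refine ⟨(injective_iff_map_eq_zero _).mpr fun z hz ↦ hinj ?_, Set.ext fun h ↦ ⟨?_, fun hh ↦ ?_⟩⟩
  · rw [map_zero, ← sum_rTensor_single_proj (((evalFamily (B := B) x).restrictScalars A).rTensor K z)]
    simp [hev, hz]
  · rintro ⟨z, rfl⟩
    exact hlin z
  · obtain ⟨w, hw⟩ := exists_rTensor_proj_eq fun i ↦ h (x i ⊗ₜ 1)
    have hw₀ : (r.mulVecLin.restrictScalars A).rTensor K w = 0 := by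
      rw [← sum_rTensor_single_proj ((r.mulVecLin.restrictScalars A).rTensor K w)]
      refine Finset.sum_eq_zero fun j _ ↦ ?_
      have : ∑ i, (r j i ⊗ₜ[A] (1 : K)) * h (x i ⊗ₜ 1) = h ((∑ i, r j i • x i) ⊗ₜ 1) := by
        rw [TensorProduct.sum_tmul, map_sum]
        exact Finset.sum_congr rfl fun i _ ↦ by rw [← hh, mul_one]
      simp only [hrel, hw, this, hr, TensorProduct.zero_tmul, map_zero]
    obtain ⟨z, rfl⟩ := (hexact w).mp hw₀
    refine ⟨z, AddMonoidHom.ext fun t ↦ ?_⟩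
    induction t with
    | zero => simp
    | add t t' ht ht' => rw [map_add, map_add, ht, ht']
    | tmul m c =>
      have hm : m ∈ Submodule.span B (Set.range x) := hx ▸ Submodule.mem_top
      induction hm using Submodule.span_induction generalizing c with
      | zero => simp
      | add m m' _ _ hm hm' => rw [TensorProduct.add_tmul, map_add, map_add, hm, hm']
      | smul b m _ hm =>
        rw [← one_mul c, hlin, hh, hm]
      | mem m hm =>
        obtain ⟨i, rfl⟩ := hm
        have key := (hev z i).symm.trans (hw i)
        have h₁ := hlin z 1 c (x i) 1
        have h₂ := hh 1 c (x i) 1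
        rw [one_smul, mul_one] at h₁ h₂
        rw [h₁, h₂, key]

/-- Let `A` be a Noetherian integral domain, `B` an `A`-algebra of finite type and `M`
a finite `B`-module.  Then there is a nonzero `f ∈ A` such that for every field `κ`
and ring homomorphism `A → κ` sending `f` to a nonzero element, the canonical map
`Hom_B(M, B) ⊗_A κ → Hom_{B ⊗_A κ}(M ⊗_A κ, B ⊗_A κ)`, `φ ⊗ c ↦ (m ⊗ d ↦ φ(m) ⊗ cd)`,
is bijective.  The target is encoded as the set of additive maps
`h : M ⊗_A κ →+ B ⊗_A κ` that are `(B ⊗_A κ)`-linear, i.e. satisfy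
`h ((b • m) ⊗ (c * d)) = (b ⊗ c) * h (m ⊗ d)`; the assertion is that any additive map
`Φ` with the prescribed formula on pure tensors is injective with range exactly this
set of `(B ⊗_A κ)`-linear maps. -/
theorem stmt_3.{u} (A : Type u) [CommRing A] [IsDomain A] [IsNoetherianRing A]
    (B : Type u) [CommRing B] [Algebra A B] [Algebra.FiniteType A B]
    (M : Type u) [AddCommGroup M] [Module A M] [Module B M] [IsScalarTower A B M]
    [Module.Finite B M] :
    ∃ f : A, f ≠ 0 ∧
      ∀ (κ : Type u) [Field κ] (g : A →+* κ), g f ≠ 0 →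
        letI : Algebra A κ := g.toAlgebra
        ∀ Φ : TensorProduct A (M →ₗ[B] B) κ →+
            ((TensorProduct A M κ) →+ (TensorProduct A B κ)),
          (∀ (φ : M →ₗ[B] B) (c : κ) (m : M) (d : κ),
            Φ (φ ⊗ₜ[A] c) (m ⊗ₜ[A] d) = φ m ⊗ₜ[A] (c * d)) →
          Function.Injective Φ ∧
            Set.range Φ = {h : (TensorProduct A M κ) →+ (TensorProduct A B κ) |
              ∀ (b : B) (c : κ) (m : M) (d : κ),
                h ((b • m) ⊗ₜ[A] (c * d)) = (b ⊗ₜ[A] c) * h (m ⊗ₜ[A] d)} := by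
  have : IsNoetherianRing B := Algebra.FiniteType.isNoetherianRing A B
  have : Module.FinitePresentation B M := Module.finitePresentation_of_finite B M
  obtain ⟨n, m, p, q, hp, hpq⟩ := Module.FinitePresentation.exists_fin' B M
  obtain ⟨f, hf, hfK⟩ := exact_rTensor_of_genericallyFlat
    (evalFamily_injective (span_range_map_single hp))
    (exact_evalFamily hp hpq) (genericallyFlat_of_finiteType (A := A) (B := B))
    (genericallyFlat_of_finiteType (A := A) (B := B))
  refine ⟨f, hf, fun κ _ g hg ↦ ?_⟩
  let _ : Algebra A κ := g.toAlgebra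
  obtain ⟨hinj, hexact⟩ := hfK κ (IsUnit.mk0 _ hg)
  exact bijective_of_exact (span_range_map_single hp) (sum_toMatrix_smul hpq) hinj hexact
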